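/- Fix an integer k ≥ 3 and a real δ ∈ (0,1). There exist c > 0 and N such that for all n ≥ N, the number of H ∈ B_n that are not δ-typical is at most |B_n| · 2^{−c·n²}. -/

import Mathlib

open Finset

/-- `H` is a `k`-graph on `[n]`: every edge is a `k`-element subset. -/
def IsKGraph (n k : ℕ) (H : Finset (Finset (Fin n))) : Prop :=
  ∀ e ∈ H, e.card = k

/-- `X, Y` is a bipartition of the hypergraph `H` on `[n]`. -/
def IsBipartition (n : ℕ) (H : Finset (Finset (Fin n))) (X Y : Finset (Fin n)) : Prop :=
  Disjoint X Y ∧ X ∪ Y = Finset.univ ∧ ∀ e ∈ H, ¬ e ⊆ X ∧ ¬ e ⊆ Y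

/-- `B_n`: the collection of all bipartite `k`-graphs on `[n]`. -/
def Bip (n k : ℕ) : Set (Finset (Finset (Fin n))) :=
  {H | IsKGraph n k H ∧ ∃ X Y : Finset (Fin n), IsBipartition n H X Y}

/-- `K[X,Y]`: the crossing `k`-sets, i.e. those contained neither in `X` nor in `Y`. -/
def crossing (n k : ℕ) (X Y : Finset (Fin n)) : Finset (Finset (Fin n)) :=
  (Finset.univ.powersetCard k).filter fun e => ¬ e ⊆ X ∧ ¬ e ⊆ Y

/-- joint `H`-degree of `u` and `v`: the number of `(k-1)`-sets `J ⊆ [n] \ {u,v}`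
with `{u} ∪ J ∈ H` and `{v} ∪ J ∈ H`. -/
def jointDeg (n k : ℕ) (H : Finset (Finset (Fin n))) (u v : Fin n) : ℕ :=
  (((Finset.univ \ {u, v}).powersetCard (k - 1)).filter
    fun J => insert u J ∈ H ∧ insert v J ∈ H).card

/-- `deg_H(v, U)`: the number of `(k-1)`-sets `J ⊆ U \ {v}` with `{v} ∪ J ∈ H`. -/
def degIn (n k : ℕ) (H : Finset (Finset (Fin n))) (v : Fin n) (U : Finset (Fin n)) : ℕ :=
  (((U \ {v}).powersetCard (k - 1)).filter fun J => insert v J ∈ H).card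

/-- `e_{H_J}(A, B)`: for disjoint `A`, `B`, the number of link-graph edges of `H_J`
with one endpoint in `A` and one in `B`. -/
def linkBetween (n : ℕ) (H : Finset (Finset (Fin n))) (J A B : Finset (Fin n)) : ℕ :=
  ((A ×ˢ B).filter fun p => p.1 ∉ J ∧ p.2 ∉ J ∧ insert p.1 (insert p.2 J) ∈ H).card

/-- `e_{H_J}(A)`: the number of link-graph edges of `H_J` contained in `A`. -/
def linkWithin (n : ℕ) (H : Finset (Finset (Fin n))) (J A : Finset (Fin n)) : ℕ :=
  ((A.powersetCard 2).filter fun p => Disjoint p J ∧ p ∪ J ∈ H).card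

/-- The bipartition `X, Y` is `δ`-typical w.r.t. `H`: properties (P), (Q), (R). -/
def DeltaTypicalWrt (n k : ℕ) (δ : ℝ) (H : Finset (Finset (Fin n)))
    (X Y : Finset (Fin n)) : Prop :=
  ((1 - δ) * n / 2 ≤ (X.card : ℝ) ∧ (X.card : ℝ) ≤ (1 + δ) * n / 2 ∧
   (1 - δ) * n / 2 ≤ (Y.card : ℝ) ∧ (Y.card : ℝ) ≤ (1 + δ) * n / 2) ∧
  ((∀ x ∈ X, |(degIn n k H x Y : ℝ) - (1 / 2 : ℝ) * (Y.card.choose (k - 1) : ℝ)|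
      ≤ δ * ((1 / 2 : ℝ) * (Y.card.choose (k - 1) : ℝ))) ∧
   (∀ y ∈ Y, |(degIn n k H y X : ℝ) - (1 / 2 : ℝ) * (X.card.choose (k - 1) : ℝ)|
      ≤ δ * ((1 / 2 : ℝ) * (X.card.choose (k - 1) : ℝ)))) ∧
  (∀ J X₀ Y₀ : Finset (Fin n), J.card = k - 2 → X₀ ⊆ X → Y₀ ⊆ Y →
    Disjoint J X₀ → Disjoint J Y₀ → Disjoint X₀ Y₀ →
    δ * n < (X₀.card : ℝ) → δ * n < (Y₀.card : ℝ) →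
    (|(linkBetween n H J X₀ Y₀ : ℝ) - (1 / 2 : ℝ) * (X₀.card : ℝ) * (Y₀.card : ℝ)|
        ≤ δ * ((1 / 2 : ℝ) * (X₀.card : ℝ) * (Y₀.card : ℝ))) ∧
    ((J ⊆ X → linkWithin n H J X₀ = 0) ∧
     (¬ J ⊆ X → |(linkWithin n H J X₀ : ℝ) - (1 / 2 : ℝ) * (X₀.card.choose 2 : ℝ)|
        ≤ δ * ((1 / 2 : ℝ) * (X₀.card.choose 2 : ℝ)))) ∧
    ((J ⊆ Y → linkWithin n H J Y₀ = 0) ∧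
     (¬ J ⊆ Y → |(linkWithin n H J Y₀ : ℝ) - (1 / 2 : ℝ) * (Y₀.card.choose 2 : ℝ)|
        ≤ δ * ((1 / 2 : ℝ) * (Y₀.card.choose 2 : ℝ)))))

/-- `H` is `δ`-typical: every bipartition of `H` is `δ`-typical w.r.t. `H`. -/
def DeltaTypical (n k : ℕ) (δ : ℝ) (H : Finset (Finset (Fin n))) : Prop :=
  ∀ X Y : Finset (Fin n), IsBipartition n H X Y → DeltaTypicalWrt n k δ H X Y

/-- Hoeffding's upper tail bound for the size of a uniformly random subset. -/
lemma card_filter_powerset_upper_tail {α : Type*} (S : Finset α) (δ : ℝ) (hδ : 0 < δ) :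
    ((S.powerset.filter fun T => δ * #S < 2 * (#T : ℝ) - #S).card : ℝ)
      ≤ 2 ^ #S * Real.exp (-(δ ^ 2 * #S / 2)) := by
  have hsum : ∑ T ∈ S.powerset, Real.exp (δ * (2 * (#T : ℝ) - #S))
      = (Real.exp δ + Real.exp (-δ)) ^ #S := by
    rw [← Finset.sum_pow_mul_eq_add_pow]
    refine Finset.sum_congr rfl fun T hT => ?_
    have h := Finset.card_le_card (Finset.mem_powerset.1 hT)
    rw [← Real.exp_nat_mul, ← Real.exp_nat_mul, ← Real.exp_add, Nat.cast_sub h]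
    congr 1
    ring
  have hcosh : (Real.exp δ + Real.exp (-δ)) ^ #S ≤ 2 ^ #S * Real.exp (δ ^ 2 * #S / 2) := by
    have h1 := Real.cosh_le_exp_half_sq δ
    rw [Real.cosh_eq] at h1
    have h2 : Real.exp δ + Real.exp (-δ) ≤ 2 * Real.exp (δ ^ 2 / 2) := by linarith
    calc _ ≤ (2 * Real.exp (δ ^ 2 / 2)) ^ #S := by gcongr
      _ = _ := by
        rw [mul_pow, ← Real.exp_nat_mul]
        congr 2
        ring
  have hmarkov : ((S.powerset.filter fun T => δ * #S < 2 * (#T : ℝ) - #S).card : ℝ)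
      * Real.exp (δ ^ 2 * #S) ≤ ∑ T ∈ S.powerset, Real.exp (δ * (2 * (#T : ℝ) - #S)) := by
    rw [← nsmul_eq_mul]
    refine (Finset.card_nsmul_le_sum _ _ _ fun T hT => ?_).trans
      (Finset.sum_le_sum_of_subset_of_nonneg (Finset.filter_subset _ _)
        fun _ _ _ => (Real.exp_pos _).le)
    have h := (Finset.mem_filter.1 hT).2
    rw [Real.exp_le_exp]
    nlinarith
  rw [hsum] at hmarkov
  have h3 := hmarkov.trans hcosh
  rw [← le_div_iff₀ (Real.exp_pos _), mul_div_assoc, ← Real.exp_sub] at h3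
  refine h3.trans (le_of_eq ?_)
  congr 2
  ring

/-- Hoeffding's two-sided bound for the size of a uniformly random subset. -/
lemma card_filter_powerset_two_tail {α : Type*} [DecidableEq α] (S : Finset α) (δ : ℝ)
    (hδ : 0 < δ) :
    ((S.powerset.filter fun T => ¬ |(#T : ℝ) - 1 / 2 * #S| ≤ δ * (1 / 2 * #S)).card : ℝ)
      ≤ 2 ^ #S * (2 * Real.exp (-(δ ^ 2 * #S / 2))) := by
  have hup := card_filter_powerset_upper_tail S δ hδ
  have hlow : (S.powerset.filter fun T => δ * #S < #S - 2 * (#T : ℝ)).card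
      ≤ (S.powerset.filter fun T => δ * #S < 2 * (#T : ℝ) - #S).card := by
    refine Finset.card_le_card_of_injOn (fun T => S \ T) ?_ ?_
    · intro T hT
      simp only [Finset.coe_filter, Finset.mem_powerset, Set.mem_ofPred_eq] at hT ⊢
      refine ⟨Finset.sdiff_subset, ?_⟩
      rw [Finset.card_sdiff_of_subset hT.1, Nat.cast_sub (Finset.card_le_card hT.1)]
      linarith [hT.2]
    · intro T hT U hU h
      simp only [Finset.coe_filter, Finset.mem_powerset, Set.mem_ofPred_eq] at hT hU
      have h' := congrArg (fun V => S \ V) h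
      simpa [Finset.inter_eq_right.2 hT.1, Finset.inter_eq_right.2 hU.1] using h'
  have hsub : (S.powerset.filter fun T => ¬ |(#T : ℝ) - 1 / 2 * #S| ≤ δ * (1 / 2 * #S))
      ⊆ (S.powerset.filter fun T => δ * #S < 2 * (#T : ℝ) - #S)
        ∪ (S.powerset.filter fun T => δ * #S < #S - 2 * (#T : ℝ)) := by
    intro T hT
    simp only [Finset.mem_filter, Finset.mem_union, not_le, lt_abs] at hT ⊢
    rcases hT with ⟨hT, h | h⟩
    · left; exact ⟨hT, by linarith⟩
    · right; exact ⟨hT, by linarith⟩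
  have h1 := (Finset.card_le_card hsub).trans (Finset.card_union_le _ _)
  have h2 : ((S.powerset.filter fun T =>
      ¬ |(#T : ℝ) - 1 / 2 * #S| ≤ δ * (1 / 2 * #S)).card : ℝ)
      ≤ (S.powerset.filter fun T => δ * #S < 2 * (#T : ℝ) - #S).card
        + (S.powerset.filter fun T => δ * #S < 2 * (#T : ℝ) - #S).card := by
    exact_mod_cast h1.trans (Nat.add_le_add_left hlow _)
  linarith

/-- Few subsets `H` of `K` contain a proportion far from one half of the elements `f p` of `K`,
where `p` ranges over a finite set on which `f` is injective. -/
lemma card_filter_powerset_deviation {α ι : Type*} [DecidableEq α] (K : Finset α)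
    (P : Finset ι) (f : ι → α) (hf : Set.InjOn f P) (hK : ∀ p ∈ P, f p ∈ K)
    (δ : ℝ) (hδ : 0 < δ) :
    ((K.powerset.filter fun H =>
        ¬ |((P.filter fun p => f p ∈ H).card : ℝ) - 1 / 2 * #P| ≤ δ * (1 / 2 * #P)).card : ℝ)
      ≤ 2 ^ #K * (2 * Real.exp (-(δ ^ 2 * #P / 2))) := by
  set S := P.image f with hS
  have hcard : #S = #P := Finset.card_image_of_injOn hf
  have hSK : S ⊆ K := Finset.image_subset_iff.2 hK
  have hcount : ∀ H : Finset α, (P.filter fun p => f p ∈ H).card = #(H ∩ S) := by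
    intro H
    rw [← Finset.card_image_of_injOn (hf.mono (Finset.coe_subset.2 (Finset.filter_subset _ _)))]
    congr 1
    ext a
    simp only [Finset.mem_image, Finset.mem_filter, Finset.mem_inter, hS]
    grind
  have hinj : (K.powerset.filter fun H =>
        ¬ |((P.filter fun p => f p ∈ H).card : ℝ) - 1 / 2 * #P| ≤ δ * (1 / 2 * #P)).card
      ≤ ((S.powerset.filter fun T => ¬ |(#T : ℝ) - 1 / 2 * #S| ≤ δ * (1 / 2 * #S))
          ×ˢ (K \ S).powerset).card := by
    refine Finset.card_le_card_of_injOn (fun H => (H ∩ S, H \ S)) ?_ ?_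
    · intro H hH
      simp only [Finset.coe_filter, Finset.mem_powerset, Set.mem_ofPred_eq, hcount,
        ← hcard] at hH
      simp only [Finset.coe_product, Set.mem_prod, Finset.mem_coe, Finset.mem_filter,
        Finset.mem_powerset]
      exact ⟨⟨Finset.inter_subset_right, hH.2⟩, Finset.sdiff_subset_sdiff hH.1 subset_rfl⟩
    · intro H _ H' _ h
      simp only [Prod.mk.injEq] at h
      rw [← Finset.sdiff_union_inter H S, ← Finset.sdiff_union_inter H' S, h.1, h.2]
  rw [Finset.card_product, Finset.card_powerset, Finset.card_sdiff_of_subset hSK] at hinj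
  have h2 := card_filter_powerset_two_tail S δ hδ
  have hpow : (2 : ℝ) ^ #K = 2 ^ #S * 2 ^ (#K - #S) := by
    rw [← pow_add, Nat.add_sub_cancel' (Finset.card_le_card hSK)]
  calc _ ≤ ((S.powerset.filter fun T =>
        ¬ |(#T : ℝ) - 1 / 2 * #S| ≤ δ * (1 / 2 * #S)).card : ℝ) * 2 ^ (#K - #S) := by
        exact_mod_cast hinj
    _ ≤ 2 ^ #S * (2 * Real.exp (-(δ ^ 2 * #S / 2))) * 2 ^ (#K - #S) := by gcongr
    _ = _ := by rw [hpow, hcard]; ring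

lemma card_filter_exists_le {α ι : Type*} (A : Finset α) (I : Finset ι)
    (p : ι → α → Prop) [∀ i, DecidablePred (p i)] [DecidablePred fun a => ∃ i ∈ I, p i a]
    (b : ℝ) (h : ∀ i ∈ I, ((A.filter (p i)).card : ℝ) ≤ b) :
    ((A.filter fun a => ∃ i ∈ I, p i a).card : ℝ) ≤ #I * b := by
  classical
  have hsub : (A.filter fun a => ∃ i ∈ I, p i a) ⊆ I.biUnion fun i => A.filter (p i) := by
    intro a ha
    simp only [Finset.mem_filter, Finset.mem_biUnion] at ha ⊢
    obtain ⟨ha, i, hi, hp⟩ := ha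
    exact ⟨i, hi, ha, hp⟩
  calc _ ≤ ((∑ i ∈ I, (A.filter (p i)).card : ℕ) : ℝ) := by
        exact_mod_cast (Finset.card_le_card hsub).trans Finset.card_biUnion_le
    _ ≤ ∑ i ∈ I, b := by push_cast; exact Finset.sum_le_sum h
    _ = _ := by simp

lemma exists_mul_sq_le_choose (r : ℕ) (hr : 2 ≤ r) (ε : ℝ) (hε : 0 < ε) :
    ∃ κ : ℝ, 0 < κ ∧ ∃ N : ℕ, ∀ n : ℕ, N ≤ n → ∀ m : ℕ, ε * n ≤ m →
      κ * (n : ℝ) ^ 2 ≤ (m.choose r : ℝ) := by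
  refine ⟨ε ^ 2 / (4 * r.factorial), by positivity, ⌈2 * r / ε⌉₊, fun n hn m hm => ?_⟩
  have h1 : 2 * r / ε ≤ (n : ℝ) := (Nat.le_ceil _).trans (by exact_mod_cast hn)
  rw [div_le_iff₀ hε] at h1
  have h2 : (2 * r : ℝ) ≤ m := by linarith
  have h2' : 2 * r ≤ m := by exact_mod_cast h2
  have h3 := Nat.pow_le_choose (α := ℝ) r m
  refine le_trans ?_ h3
  have h4 : ((m + 1 - r : ℕ) : ℝ) = m + 1 - r := by
    rw [Nat.cast_sub (by omega)]; push_cast; ring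
  have hr' : (2 : ℝ) ≤ r := by exact_mod_cast hr
  have h5 : ε * n / 2 ≤ ((m + 1 - r : ℕ) : ℝ) := by rw [h4]; linarith
  have h6 : (1 : ℝ) ≤ ((m + 1 - r : ℕ) : ℝ) := by rw [h4]; linarith
  have h7 : (ε * n / 2) ^ 2 ≤ (((m + 1 - r : ℕ) : ℝ)) ^ r :=
    (pow_le_pow_left₀ (by positivity) h5 2).trans (pow_le_pow_right₀ h6 hr)
  calc ε ^ 2 / (4 * r.factorial) * (n : ℝ) ^ 2 = (ε * n / 2) ^ 2 / r.factorial := by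
        field_simp; ring
    _ ≤ _ := by gcongr

lemma choose_add_choose_le (a b r : ℕ) (hr : 1 ≤ r) :
    a.choose r + b.choose r ≤ (a + b).choose r := by
  rw [Nat.add_choose_eq]
  have hne : ((r, 0) : ℕ × ℕ) ≠ (0, r) := by simp; omega
  have h := Finset.sum_le_sum_of_subset (f := fun ij : ℕ × ℕ => a.choose ij.1 * b.choose ij.2)
    (s := {(r, 0), (0, r)}) (t := Finset.HasAntidiagonal.antidiagonal r) (by
      intro p hp
      simp only [Finset.mem_insert, Finset.mem_singleton] at hp
      rcases hp with rfl | rfl <;> simp)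
  rw [Finset.sum_pair hne] at h
  simpa using h

lemma crossing_comm (n k : ℕ) (X Y : Finset (Fin n)) : crossing n k X Y = crossing n k Y X := by
  ext e
  simp only [crossing, Finset.mem_filter]
  tauto

lemma card_crossing_add (n k : ℕ) (hk : 1 ≤ k) (X Y : Finset (Fin n)) (hXY : Disjoint X Y) :
    #(crossing n k X Y) + ((#X).choose k + (#Y).choose k) = n.choose k := by
  have hdisj : Disjoint (X.powersetCard k) (Y.powersetCard k) := by
    rw [Finset.disjoint_left]
    intro e h1 h2
    rw [Finset.mem_powersetCard] at h1 h2
    have : e = ∅ := Finset.disjoint_self_iff_empty _ |>.1 (hXY.mono h1.1 h2.1)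
    rw [this] at h1
    simp at h1
    omega
  have h := Finset.card_filter_add_card_filter_not
    (s := (Finset.univ : Finset (Fin n)).powersetCard k) (fun e => ¬ e ⊆ X ∧ ¬ e ⊆ Y)
  rw [Finset.card_powersetCard, Finset.card_univ, Fintype.card_fin] at h
  rw [← h, crossing, ← Finset.card_powersetCard, ← Finset.card_powersetCard,
    ← Finset.card_union_of_disjoint hdisj]
  congr 2
  ext e
  simp only [Finset.mem_union, Finset.mem_powersetCard, Finset.mem_filter, Finset.subset_univ]
  tauto

/-- Moving one vertex from the larger to the smaller part creates many new crossing sets. -/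
lemma exists_card_crossing_le (n k : ℕ) (hk : 2 ≤ k) (X Y : Finset (Fin n))
    (hXY : Disjoint X Y) (hU : X ∪ Y = Finset.univ) (hlt : #X < #Y) :
    ∃ X' Y' : Finset (Fin n), Disjoint X' Y' ∧ X' ∪ Y' = Finset.univ ∧
      #(crossing n k X Y) + (#Y - #X - 1).choose (k - 1) ≤ #(crossing n k X' Y') := by
  obtain ⟨y, hy⟩ : Y.Nonempty := Finset.card_pos.1 (by omega)
  have hyX : y ∉ X := fun h => Finset.disjoint_left.1 hXY h hy
  have hdisj : Disjoint (insert y X) (Y.erase y) := by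
    rw [Finset.disjoint_left] at hXY ⊢
    intro a ha
    simp only [Finset.mem_insert, Finset.mem_erase] at ha ⊢
    grind
  refine ⟨insert y X, Y.erase y, hdisj, ?_, ?_⟩
  · rw [← hU]
    ext a
    simp only [Finset.mem_union, Finset.mem_insert, Finset.mem_erase]
    grind
  · have h1 := card_crossing_add n k (by omega) X Y hXY
    have h2 := card_crossing_add n k (by omega) _ _ hdisj
    rw [Finset.card_insert_of_notMem hyX, Finset.card_erase_of_mem hy] at h2
    obtain ⟨j, rfl⟩ : ∃ j, k = j + 1 := ⟨k - 1, by omega⟩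
    obtain ⟨b, hb⟩ : ∃ b, #Y = #X + b + 1 := ⟨#Y - #X - 1, by omega⟩
    have h3 := choose_add_choose_le (#X) b j (by omega)
    have h4 : #Y - #X - 1 = b := by omega
    have h5 : #Y - 1 = #X + b := by omega
    rw [h4]
    rw [h5, Nat.choose_succ_succ' (#X) j] at h2
    rw [hb, Nat.choose_succ_succ' (#X + b) j] at h1
    simp only [Nat.add_sub_cancel]
    omega

lemma two_pow_card_crossing_le (n k : ℕ) (X Y : Finset (Fin n))
    (hXY : Disjoint X Y) (hU : X ∪ Y = Finset.univ) :
    (2 : ℝ) ^ #(crossing n k X Y) ≤ ((Bip n k).ncard : ℝ) := by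
  have hsub : ((crossing n k X Y).powerset : Set (Finset (Finset (Fin n)))) ⊆ Bip n k := by
    intro H hH
    rw [Finset.mem_coe, Finset.mem_powerset] at hH
    refine ⟨fun e he => ?_, X, Y, hXY, hU, fun e he => ?_⟩
    · exact (Finset.mem_powersetCard.1 (Finset.mem_filter.1 (hH he)).1).2
    · exact (Finset.mem_filter.1 (hH he)).2
  have h := Set.ncard_le_ncard hsub (Set.toFinite _)
  rw [Set.ncard_coe_finset, Finset.card_powerset] at h
  exact_mod_cast h

lemma subset_crossing {n k : ℕ} {H : Finset (Finset (Fin n))} {X Y : Finset (Fin n)}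
    (hH : IsKGraph n k H) (hXY : IsBipartition n H X Y) : H ⊆ crossing n k X Y := fun e he =>
  Finset.mem_filter.2
    ⟨Finset.mem_powersetCard.2 ⟨Finset.subset_univ _, hH e he⟩, hXY.2.2 e he⟩

lemma mem_crossing {n k : ℕ} {X Y e : Finset (Fin n)} (hXY : Disjoint X Y) {x y : Fin n}
    (hx : x ∈ X) (hy : y ∈ Y) (hxe : x ∈ e) (hye : y ∈ e) (he : #e = k) :
    e ∈ crossing n k X Y :=
  Finset.mem_filter.2 ⟨Finset.mem_powersetCard.2 ⟨Finset.subset_univ _, he⟩,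
    fun h => Finset.disjoint_left.1 hXY (h hye) hy, fun h => Finset.disjoint_left.1 hXY hx (h hxe)⟩

lemma exp_deviation_mono (δ L m M : ℝ) (hM : 0 ≤ M) (hL : L ≤ m) :
    M * (2 * Real.exp (-(δ ^ 2 * m / 2))) ≤ M * (2 * Real.exp (-(δ ^ 2 * L / 2))) := by
  gcongr

lemma card_degIn_deviation (n k : ℕ) (hk : 2 ≤ k) (X Y : Finset (Fin n)) (hXY : Disjoint X Y)
    (δ : ℝ) (hδ : 0 < δ) (x : Fin n) (hx : x ∈ X) :
    (((crossing n k X Y).powerset.filter fun H =>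
        ¬ |(degIn n k H x Y : ℝ) - 1 / 2 * ((#Y).choose (k - 1) : ℝ)|
          ≤ δ * (1 / 2 * ((#Y).choose (k - 1) : ℝ))).card : ℝ)
      ≤ 2 ^ #(crossing n k X Y)
        * (2 * Real.exp (-(δ ^ 2 * ((#Y).choose (k - 1) : ℝ) / 2))) := by
  have hxY : x ∉ Y := Finset.disjoint_left.1 hXY hx
  have hxJ : ∀ J ∈ Y.powersetCard (k - 1), x ∉ J := fun J hJ h =>
    hxY ((Finset.mem_powersetCard.1 hJ).1 h)
  have h := card_filter_powerset_deviation (crossing n k X Y) (Y.powersetCard (k - 1))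
    (fun J => insert x J) (fun J hJ J' hJ' hJJ => by
      rw [← Finset.erase_insert (hxJ J hJ), ← Finset.erase_insert (hxJ J' hJ')]
      exact congrArg (fun e => Finset.erase e x) hJJ)
    (fun J hJ => by
      obtain ⟨hJY, hJc⟩ := Finset.mem_powersetCard.1 hJ
      obtain ⟨y, hy⟩ : J.Nonempty := Finset.card_pos.1 (by omega)
      exact mem_crossing hXY hx (hJY hy) (Finset.mem_insert_self _ _)
        (Finset.mem_insert_of_mem hy)
        (by rw [Finset.card_insert_of_notMem (hxJ J hJ)]; omega)) δ hδ
  simpa only [Finset.card_powersetCard, degIn, Finset.sdiff_singleton_eq_erase,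
    Finset.erase_eq_of_notMem hxY] using h

lemma card_linkBetween_deviation (n k : ℕ) (hk : 2 ≤ k) (X Y : Finset (Fin n))
    (hXY : Disjoint X Y) (δ : ℝ) (hδ : 0 < δ) (J A B : Finset (Fin n)) (hJ : #J = k - 2)
    (hA : A ⊆ X) (hB : B ⊆ Y) (hJA : Disjoint J A) (hJB : Disjoint J B) :
    (((crossing n k X Y).powerset.filter fun H =>
        ¬ |(linkBetween n H J A B : ℝ) - 1 / 2 * (#A : ℝ) * (#B : ℝ)|
          ≤ δ * (1 / 2 * (#A : ℝ) * (#B : ℝ))).card : ℝ)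
      ≤ 2 ^ #(crossing n k X Y) * (2 * Real.exp (-(δ ^ 2 * (#A * #B : ℝ) / 2))) := by
  have hAB : Disjoint A B := hXY.mono hA hB
  rw [Finset.disjoint_left] at hJA hJB hAB
  have h := card_filter_powerset_deviation (crossing n k X Y) (A ×ˢ B)
    (fun p => insert p.1 (insert p.2 J)) (fun p hp q hq hpq => by
      have hpq : insert p.1 (insert p.2 J) = insert q.1 (insert q.2 J) := hpq
      simp only [Finset.coe_product, Set.mem_prod, Finset.mem_coe] at hp hq
      have h1 : p.1 ∈ insert q.1 (insert q.2 J) := hpq ▸ Finset.mem_insert_self _ _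
      have h2 : p.2 ∈ insert q.1 (insert q.2 J) :=
        hpq ▸ Finset.mem_insert_of_mem (Finset.mem_insert_self _ _)
      simp only [Finset.mem_insert] at h1 h2
      ext1 <;> grind)
    (fun p hp => by
      obtain ⟨hp1, hp2⟩ := Finset.mem_product.1 hp
      refine mem_crossing hXY (hA hp1) (hB hp2) (Finset.mem_insert_self _ _)
        (Finset.mem_insert_of_mem (Finset.mem_insert_self _ _)) ?_
      rw [Finset.card_insert_of_notMem, Finset.card_insert_of_notMem (fun h => hJB h hp2)]
      · omega
      · simp only [Finset.mem_insert]
        grind) δ hδ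
  have hcount : ∀ H, linkBetween n H J A B
      = ((A ×ˢ B).filter fun p => insert p.1 (insert p.2 J) ∈ H).card := by
    intro H
    rw [linkBetween]
    congr 1
    refine Finset.filter_congr fun p hp => ?_
    rw [Finset.mem_product] at hp
    exact ⟨fun h => h.2.2, fun h => ⟨fun h' => hJA h' hp.1, fun h' => hJB h' hp.2, h⟩⟩
  simpa only [Finset.card_product, Nat.cast_mul, hcount, mul_assoc] using h

lemma card_linkWithin_deviation (n k : ℕ) (hk : 2 ≤ k) (X Y : Finset (Fin n))
    (hXY : Disjoint X Y) (hU : X ∪ Y = Finset.univ) (δ : ℝ) (hδ : 0 < δ)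
    (J A : Finset (Fin n)) (hJ : #J = k - 2)
    (hA : A ⊆ X) (hJA : Disjoint J A) (hJX : ¬ J ⊆ X) :
    (((crossing n k X Y).powerset.filter fun H =>
        ¬ |(linkWithin n H J A : ℝ) - 1 / 2 * ((#A).choose 2 : ℝ)|
          ≤ δ * (1 / 2 * ((#A).choose 2 : ℝ))).card : ℝ)
      ≤ 2 ^ #(crossing n k X Y)
        * (2 * Real.exp (-(δ ^ 2 * ((#A).choose 2 : ℝ) / 2))) := by
  have hdisj : ∀ p ∈ A.powersetCard 2, Disjoint p J := fun p hp =>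
    (hJA.mono_right (Finset.mem_powersetCard.1 hp).1).symm
  obtain ⟨y, hyJ, hyX⟩ := Finset.not_subset.1 hJX
  have hyY : y ∈ Y := by
    have : y ∈ X ∪ Y := hU ▸ Finset.mem_univ y
    exact (Finset.mem_union.1 this).resolve_left hyX
  have h := card_filter_powerset_deviation (crossing n k X Y) (A.powersetCard 2)
    (fun p => p ∪ J) (fun p hp q hq hpq => by
      rw [← Finset.union_sdiff_cancel_right (hdisj p hp),
        ← Finset.union_sdiff_cancel_right (hdisj q hq)]
      exact congrArg (fun e => e \ J) hpq)
    (fun p hp => by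
      obtain ⟨hpA, hpc⟩ := Finset.mem_powersetCard.1 hp
      obtain ⟨x, hx⟩ : p.Nonempty := Finset.card_pos.1 (by omega)
      refine mem_crossing hXY (hA (hpA hx)) hyY (Finset.mem_union_left _ hx)
        (Finset.mem_union_right _ hyJ) ?_
      rw [Finset.card_union_of_disjoint (hdisj p hp)]
      omega) δ hδ
  have hcount : ∀ H, linkWithin n H J A
      = ((A.powersetCard 2).filter fun p => p ∪ J ∈ H).card := by
    intro H
    rw [linkWithin]
    congr 1
    exact Finset.filter_congr fun p hp => ⟨fun h => h.2, fun h => ⟨hdisj p hp, h⟩⟩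
  simpa only [Finset.card_powersetCard, hcount] using h

lemma linkWithin_eq_zero {n k : ℕ} {H : Finset (Finset (Fin n))} {X Y J A : Finset (Fin n)}
    (hH : H ⊆ crossing n k X Y) (hJ : J ⊆ X) (hA : A ⊆ X) : linkWithin n H J A = 0 := by
  rw [linkWithin, Finset.card_eq_zero, Finset.filter_eq_empty_iff]
  rintro p hp ⟨-, hpH⟩
  exact (Finset.mem_filter.1 (hH hpH)).2.1
    (Finset.union_subset ((Finset.mem_powersetCard.1 hp).1.trans hA) hJ)

open Classical in
/-- Few subgraphs of the complete bipartite hypergraph on a balanced pair of parts violate the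
degree or the link condition. -/
lemma card_not_typical_le_of_balanced (n k : ℕ) (hk : 2 ≤ k) (δ : ℝ) (hδ : 0 < δ)
    (X Y : Finset (Fin n)) (hXY : Disjoint X Y) (hU : X ∪ Y = Finset.univ)
    (hbal : (1 - δ) * n / 2 ≤ (#X : ℝ) ∧ (#X : ℝ) ≤ (1 + δ) * n / 2 ∧
      (1 - δ) * n / 2 ≤ (#Y : ℝ) ∧ (#Y : ℝ) ≤ (1 + δ) * n / 2)
    (L : ℝ) (hLX : L ≤ ((#X).choose (k - 1) : ℝ)) (hLY : L ≤ ((#Y).choose (k - 1) : ℝ))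
    (hL2 : ∀ m : ℕ, δ * n < m → L ≤ (m.choose 2 : ℝ))
    (hLmul : ∀ m m' : ℕ, δ * n < m → δ * n < m' → L ≤ (m * m' : ℝ)) :
    (((crossing n k X Y).powerset.filter fun H => ¬ DeltaTypicalWrt n k δ H X Y).card : ℝ)
      ≤ 5 * 8 ^ n * (2 ^ #(crossing n k X Y) * (2 * Real.exp (-(δ ^ 2 * L / 2)))) := by
  set K := crossing n k X Y with hK
  set b : ℝ := 2 ^ #K * (2 * Real.exp (-(δ ^ 2 * L / 2))) with hb
  have hb0 : 0 ≤ b := by positivity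
  have hK' : K = crossing n k Y X := by rw [hK, crossing_comm]
  have hU' : Y ∪ X = Finset.univ := by rw [Finset.union_comm, hU]
  let T : Finset (Finset (Fin n) × Finset (Fin n) × Finset (Fin n)) :=
    Finset.univ.filter fun t => #t.1 = k - 2 ∧ t.2.1 ⊆ X ∧ t.2.2 ⊆ Y ∧ Disjoint t.1 t.2.1 ∧
      Disjoint t.1 t.2.2 ∧ δ * n < (#t.2.1 : ℝ) ∧ δ * n < (#t.2.2 : ℝ)
  have hT : (#T : ℝ) ≤ 8 ^ n := by
    have h : #T ≤ 8 ^ n := by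
      refine (Finset.card_le_univ T).trans (le_of_eq ?_)
      simp only [Fintype.card_prod, Fintype.card_finset, Fintype.card_fin]
      rw [← mul_pow, ← mul_pow]
      norm_num
    exact_mod_cast h
  have hn : ∀ Z : Finset (Fin n), (#Z : ℝ) ≤ 8 ^ n := by
    intro Z
    have h1 : #Z ≤ n := (Finset.card_le_univ Z).trans (by simp)
    have h2 : #Z ≤ 8 ^ n := h1.trans (Nat.lt_pow_self (by norm_num)).le
    exact_mod_cast h2
  have hdX := card_filter_exists_le K.powerset X (fun x H =>
    ¬ |(degIn n k H x Y : ℝ) - 1 / 2 * ((#Y).choose (k - 1) : ℝ)|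
      ≤ δ * (1 / 2 * ((#Y).choose (k - 1) : ℝ))) b fun x hx =>
    (card_degIn_deviation n k hk X Y hXY δ hδ x hx).trans
      (exp_deviation_mono _ _ _ _ (by positivity) hLY)
  have hdY := card_filter_exists_le K.powerset Y (fun y H =>
    ¬ |(degIn n k H y X : ℝ) - 1 / 2 * ((#X).choose (k - 1) : ℝ)|
      ≤ δ * (1 / 2 * ((#X).choose (k - 1) : ℝ))) b fun y hy => by
    have h := (card_degIn_deviation n k hk Y X hXY.symm δ hδ y hy).trans
      (exp_deviation_mono _ _ _ _ (by positivity) hLX)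
    rwa [← hK'] at h
  have hmul := card_filter_exists_le K.powerset T (fun t H =>
    ¬ |(linkBetween n H t.1 t.2.1 t.2.2 : ℝ) - 1 / 2 * (#t.2.1 : ℝ) * (#t.2.2 : ℝ)|
      ≤ δ * (1 / 2 * (#t.2.1 : ℝ) * (#t.2.2 : ℝ))) b fun t ht => by
    obtain ⟨-, hJ, hA, hB, hJA, hJB, hcA, hcB⟩ := Finset.mem_filter.1 ht
    exact (card_linkBetween_deviation n k hk X Y hXY δ hδ _ _ _ hJ hA hB hJA hJB).trans
      (exp_deviation_mono _ _ _ _ (by positivity) (hLmul _ _ hcA hcB))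
  have hwX := card_filter_exists_le K.powerset (T.filter fun t => ¬ t.1 ⊆ X) (fun t H =>
    ¬ |(linkWithin n H t.1 t.2.1 : ℝ) - 1 / 2 * ((#t.2.1).choose 2 : ℝ)|
      ≤ δ * (1 / 2 * ((#t.2.1).choose 2 : ℝ))) b fun t ht => by
    obtain ⟨ht, hJX⟩ := Finset.mem_filter.1 ht
    obtain ⟨-, hJ, hA, hB, hJA, hJB, hcA, hcB⟩ := Finset.mem_filter.1 ht
    exact (card_linkWithin_deviation n k hk X Y hXY hU δ hδ _ _ hJ hA hJA hJX).trans
      (exp_deviation_mono _ _ _ _ (by positivity) (hL2 _ hcA))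
  have hwY := card_filter_exists_le K.powerset (T.filter fun t => ¬ t.1 ⊆ Y) (fun t H =>
    ¬ |(linkWithin n H t.1 t.2.2 : ℝ) - 1 / 2 * ((#t.2.2).choose 2 : ℝ)|
      ≤ δ * (1 / 2 * ((#t.2.2).choose 2 : ℝ))) b fun t ht => by
    obtain ⟨ht, hJY⟩ := Finset.mem_filter.1 ht
    obtain ⟨-, hJ, hA, hB, hJA, hJB, hcA, hcB⟩ := Finset.mem_filter.1 ht
    have h := (card_linkWithin_deviation n k hk Y X hXY.symm hU' δ hδ _ _ hJ hB hJB hJY).trans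
      (exp_deviation_mono _ _ _ _ (by positivity) (hL2 _ hcB))
    rwa [← hK'] at h
  have hTX : (#(T.filter fun t => ¬ t.1 ⊆ X) : ℝ) ≤ 8 ^ n :=
    (Nat.cast_le.2 (Finset.card_filter_le _ _)).trans hT
  have hTY : (#(T.filter fun t => ¬ t.1 ⊆ Y) : ℝ) ≤ 8 ^ n :=
    (Nat.cast_le.2 (Finset.card_filter_le _ _)).trans hT
  have hdX' := hdX.trans (mul_le_mul_of_nonneg_right (hn X) hb0)
  have hdY' := hdY.trans (mul_le_mul_of_nonneg_right (hn Y) hb0)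
  have hmul' := hmul.trans (mul_le_mul_of_nonneg_right hT hb0)
  have hwX' := hwX.trans (mul_le_mul_of_nonneg_right hTX hb0)
  have hwY' := hwY.trans (mul_le_mul_of_nonneg_right hTY hb0)
  clear hdX hdY hmul hwX hwY
  have hcover : ∀ H ∈ K.powerset.filter (fun H => ¬ DeltaTypicalWrt n k δ H X Y),
      H ∈ (K.powerset.filter fun H => ∃ x ∈ X,
          ¬ |(degIn n k H x Y : ℝ) - 1 / 2 * ((#Y).choose (k - 1) : ℝ)|
            ≤ δ * (1 / 2 * ((#Y).choose (k - 1) : ℝ))) ∪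
        ((K.powerset.filter fun H => ∃ y ∈ Y,
          ¬ |(degIn n k H y X : ℝ) - 1 / 2 * ((#X).choose (k - 1) : ℝ)|
            ≤ δ * (1 / 2 * ((#X).choose (k - 1) : ℝ))) ∪
        ((K.powerset.filter fun H => ∃ t ∈ T,
          ¬ |(linkBetween n H t.1 t.2.1 t.2.2 : ℝ) - 1 / 2 * (#t.2.1 : ℝ) * (#t.2.2 : ℝ)|
            ≤ δ * (1 / 2 * (#t.2.1 : ℝ) * (#t.2.2 : ℝ))) ∪
        ((K.powerset.filter fun H => ∃ t ∈ T.filter fun t => ¬ t.1 ⊆ X,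
          ¬ |(linkWithin n H t.1 t.2.1 : ℝ) - 1 / 2 * ((#t.2.1).choose 2 : ℝ)|
            ≤ δ * (1 / 2 * ((#t.2.1).choose 2 : ℝ))) ∪
        (K.powerset.filter fun H => ∃ t ∈ T.filter fun t => ¬ t.1 ⊆ Y,
          ¬ |(linkWithin n H t.1 t.2.2 : ℝ) - 1 / 2 * ((#t.2.2).choose 2 : ℝ)|
            ≤ δ * (1 / 2 * ((#t.2.2).choose 2 : ℝ)))))) := by
    intro H hH
    obtain ⟨hHK, hnot⟩ := Finset.mem_filter.1 hH
    by_contra hcon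
    simp only [Finset.mem_union, Finset.mem_filter, hHK, true_and, not_or, not_exists, not_and,
      not_not] at hcon
    obtain ⟨c1, c2, c3, c4, c5⟩ := hcon
    have hHK' := Finset.mem_powerset.1 hHK
    refine hnot ⟨hbal, ⟨c1, c2⟩, fun J A B hJ hA hB hJA hJB _ hcA hcB => ?_⟩
    have ht : (J, A, B) ∈ T :=
      Finset.mem_filter.2 ⟨Finset.mem_univ _, hJ, hA, hB, hJA, hJB, hcA, hcB⟩
    exact ⟨c3 (J, A, B) ht,
      ⟨fun h => linkWithin_eq_zero hHK' h hA, fun h => c4 (J, A, B) ⟨ht, h⟩⟩,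
      ⟨fun h => linkWithin_eq_zero (hHK'.trans hK'.subset) h hB, fun h => c5 (J, A, B) ⟨ht, h⟩⟩⟩
  have hcard := Finset.card_le_card hcover
  have hcard' := Nat.cast_le (α := ℝ).2 (hcard.trans ((Finset.card_union_le _ _).trans
    (Nat.add_le_add_left ((Finset.card_union_le _ _).trans
      (Nat.add_le_add_left ((Finset.card_union_le _ _).trans
        (Nat.add_le_add_left (Finset.card_union_le _ _) _)) _)) _)))
  push_cast at hcard'
  have hsum : 8 ^ n * b + (8 ^ n * b + (8 ^ n * b + (8 ^ n * b + 8 ^ n * b)))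
      = 5 * 8 ^ n * b := by ring
  rw [← hsum]
  refine hcard'.trans
    (add_le_add ?_ (add_le_add ?_ (add_le_add ?_ (add_le_add ?_ ?_))))
  · convert hdX'
  · convert hdY'
  · convert hmul'
  · refine (le_of_eq ?_).trans hwX'
    congr!
  · refine (le_of_eq ?_).trans hwY'
    congr!

lemma card_crossing_powerset_le_of_card_lt (n k : ℕ) (hk : 2 ≤ k) (X Y : Finset (Fin n))
    (hXY : Disjoint X Y) (hU : X ∪ Y = Finset.univ) (hlt : #X < #Y) (L : ℝ)
    (hL : L ≤ ((#Y - #X - 1).choose (k - 1) : ℝ)) :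
    (2 : ℝ) ^ #(crossing n k X Y) ≤ ((Bip n k).ncard : ℝ) * Real.exp (-(L / 2)) := by
  obtain ⟨X', Y', hXY', hU', hcard⟩ := exists_card_crossing_le n k hk X Y hXY hU hlt
  have h1 := two_pow_card_crossing_le n k X' Y' hXY' hU'
  set g := (#Y - #X - 1).choose (k - 1)
  have h2 : (2 : ℝ) ^ #(crossing n k X Y) * 2 ^ g ≤ ((Bip n k).ncard : ℝ) := by
    rw [← pow_add]
    exact (pow_le_pow_right₀ (by norm_num) hcard).trans h1
  have h3 : Real.exp (L / 2) ≤ 2 ^ g := by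
    rw [← Real.exp_log (show (0 : ℝ) < 2 ^ g by positivity), Real.exp_le_exp, Real.log_pow]
    nlinarith [Real.log_two_gt_d9]
  rw [Real.exp_neg, ← div_eq_mul_inv, le_div_iff₀ (Real.exp_pos _)]
  exact (mul_le_mul_of_nonneg_left h3 (by positivity)).trans h2

open Classical in
/-- For every pair of parts, few subgraphs of the complete bipartite hypergraph are not typical,
relative to the number of all bipartite hypergraphs. -/
lemma exists_card_not_typical_le (k : ℕ) (hk : 3 ≤ k) (δ : ℝ) (hδ0 : 0 < δ) (hδ1 : δ < 1) :
    ∃ κ : ℝ, 0 < κ ∧ ∃ N : ℕ, ∀ n : ℕ, N ≤ n → ∀ X Y : Finset (Fin n), Disjoint X Y →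
      X ∪ Y = Finset.univ →
      (((crossing n k X Y).powerset.filter fun H => ¬ DeltaTypicalWrt n k δ H X Y).card : ℝ)
        ≤ 5 * 8 ^ n * (((Bip n k).ncard : ℝ)
          * (2 * Real.exp (-(δ ^ 2 * (κ * (n : ℝ) ^ 2) / 2)))) := by
  set ε := min (δ / 2) ((1 - δ) / 2) with hε
  have hε0 : 0 < ε := lt_min (by linarith) (by linarith)
  have hεδ : ε ≤ δ / 2 := min_le_left _ _
  have hεδ' : ε ≤ (1 - δ) / 2 := min_le_right _ _
  obtain ⟨κ₁, hκ₁, N₁, hchoose₁⟩ := exists_mul_sq_le_choose (k - 1) (by omega) ε hε0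
  obtain ⟨κ₂, hκ₂, N₂, hchoose₂⟩ := exists_mul_sq_le_choose 2 le_rfl ε hε0
  set κ := min κ₁ (min κ₂ (δ ^ 2)) with hκ
  have hκ0 : 0 < κ := lt_min hκ₁ (lt_min hκ₂ (by positivity))
  refine ⟨κ, hκ0, max N₁ (max N₂ ⌈2 / δ⌉₊), fun n hn X Y hXY hU => ?_⟩
  have hn1 : N₁ ≤ n := (le_max_left _ _).trans hn
  have hn2 : N₂ ≤ n := (le_max_left _ _).trans ((le_max_right _ _).trans hn)
  have hn3 : 2 / δ ≤ n := (Nat.le_ceil _).trans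
    (by exact_mod_cast (le_max_right _ _).trans ((le_max_right _ _).trans hn))
  rw [div_le_iff₀ hδ0] at hn3
  have hn0 : (0 : ℝ) ≤ n := Nat.cast_nonneg n
  have hε1 : ε * n ≤ δ / 2 * n := by gcongr
  have hε2 : ε * n ≤ (1 - δ) / 2 * n := by gcongr
  set L := κ * (n : ℝ) ^ 2 with hL
  have hL0 : 0 ≤ L := by positivity
  have hL₁ : ∀ m : ℕ, ε * n ≤ m → L ≤ (m.choose (k - 1) : ℝ) := fun m hm =>
    (mul_le_mul_of_nonneg_right (min_le_left _ _) (by positivity)).trans (hchoose₁ n hn1 m hm)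
  have hL₂ : ∀ m : ℕ, ε * n ≤ m → L ≤ (m.choose 2 : ℝ) := fun m hm =>
    (mul_le_mul_of_nonneg_right ((min_le_right _ _).trans (min_le_left _ _))
      (by positivity)).trans (hchoose₂ n hn2 m hm)
  have hL₃ : L ≤ δ ^ 2 * n ^ 2 :=
    mul_le_mul_of_nonneg_right ((min_le_right _ _).trans (min_le_right _ _)) (by positivity)
  have hXYn : (#X : ℝ) + #Y = n := by
    have h := Finset.card_union_of_disjoint hXY
    rw [hU, Finset.card_univ, Fintype.card_fin] at h
    exact_mod_cast h.symm
  have hB := two_pow_card_crossing_le n k X Y hXY hU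
  by_cases hbal : (1 - δ) * n / 2 ≤ (#X : ℝ) ∧ (#X : ℝ) ≤ (1 + δ) * n / 2 ∧
      (1 - δ) * n / 2 ≤ (#Y : ℝ) ∧ (#Y : ℝ) ≤ (1 + δ) * n / 2
  · refine (card_not_typical_le_of_balanced n k (by omega) δ hδ0 X Y hXY hU hbal L
      (hL₁ _ (by linarith [hbal.1])) (hL₁ _ (by linarith [hbal.2.2.1]))
      (fun m hm => hL₂ m (by linarith [mul_nonneg hδ0.le hn0]))
      (fun m m' hm hm' => ?_)).trans (by gcongr)
    have hδn : 0 ≤ δ * n := by positivity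
    calc L ≤ (δ * n) * (δ * n) := by linarith
      _ ≤ _ := mul_le_mul hm.le hm'.le hδn (hδn.trans hm.le)
  · have hfilter : (((crossing n k X Y).powerset.filter
        fun H => ¬ DeltaTypicalWrt n k δ H X Y).card : ℝ) ≤ 2 ^ #(crossing n k X Y) := by
      have h := Finset.card_filter_le (crossing n k X Y).powerset
        fun H => ¬ DeltaTypicalWrt n k δ H X Y
      rw [Finset.card_powerset] at h
      exact_mod_cast h
    have hgap : ∀ a b : ℕ, δ * n < (b : ℝ) - a →
        a < b ∧ L ≤ ((b - a - 1).choose (k - 1) : ℝ) := by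
      intro a b hab
      have hlt : (a : ℝ) + 1 < b := by linarith
      have hlt' : a + 1 < b := by exact_mod_cast hlt
      refine ⟨by omega, hL₁ _ ?_⟩
      rw [Nat.sub_sub, Nat.cast_sub hlt'.le]
      push_cast
      linarith
    have hunbal : (2 : ℝ) ^ #(crossing n k X Y)
        ≤ ((Bip n k).ncard : ℝ) * Real.exp (-(L / 2)) := by
      rcases lt_or_ge (δ * n) ((#Y : ℝ) - #X) with h | h
      · obtain ⟨h1, h2⟩ := hgap _ _ h
        exact card_crossing_powerset_le_of_card_lt n k (by omega) X Y hXY hU h1 L h2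
      · rcases lt_or_ge (δ * n) ((#X : ℝ) - #Y) with h' | h'
        · obtain ⟨h1, h2⟩ := hgap _ _ h'
          rw [crossing_comm]
          exact card_crossing_powerset_le_of_card_lt n k (by omega) Y X hXY.symm
            (by rw [Finset.union_comm, hU]) h1 L h2
        · exact absurd ⟨by linarith, by linarith, by linarith, by linarith⟩ hbal
    have hexp : Real.exp (-(L / 2)) ≤ Real.exp (-(δ ^ 2 * L / 2)) := by
      rw [Real.exp_le_exp]
      nlinarith [mul_nonneg (sub_nonneg.2 (pow_le_one₀ hδ0.le hδ1.le : δ ^ 2 ≤ 1)) hL0]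
    have h8 : (1 : ℝ) ≤ 5 * 8 ^ n := by
      have : (1 : ℝ) ≤ 8 ^ n := one_le_pow₀ (by norm_num)
      linarith
    have hpos := (Real.exp_pos (-(δ ^ 2 * L / 2))).le
    calc _ ≤ _ := hfilter
      _ ≤ _ := hunbal
      _ ≤ ((Bip n k).ncard : ℝ) * (2 * Real.exp (-(δ ^ 2 * L / 2))) := by
        gcongr
        linarith
      _ ≤ _ := le_mul_of_one_le_left (by positivity) h8

theorem stmt14 (k : ℕ) (hk : 3 ≤ k) (δ : ℝ) (hδ0 : 0 < δ) (hδ1 : δ < 1) :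
    ∃ c : ℝ, 0 < c ∧ ∃ N : ℕ, ∀ n : ℕ, N ≤ n →
      (({H ∈ Bip n k | ¬ DeltaTypical n k δ H}.ncard : ℝ))
        ≤ ((Bip n k).ncard : ℝ) * (2 : ℝ) ^ (-(c * (n : ℝ) ^ 2)) := by
  obtain ⟨κ, hκ, N, hpair⟩ := exists_card_not_typical_le k hk δ hδ0 hδ1
  set c := δ ^ 2 * κ / 4 with hc
  have hc0 : 0 < c := by positivity
  refine ⟨c, hc0, max N (max 1 ⌈6 / c⌉₊), fun n hn => ?_⟩
  classical
  have hn1 : N ≤ n := (le_max_left _ _).trans hn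
  have hn2 : 1 ≤ n := (le_max_left _ _).trans ((le_max_right _ _).trans hn)
  have hn3 : 6 / c ≤ n := (Nat.le_ceil _).trans
    (by exact_mod_cast (le_max_right _ _).trans ((le_max_right _ _).trans hn))
  rw [div_le_iff₀ hc0] at hn3
  have hn2' : (1 : ℝ) ≤ n := by exact_mod_cast hn2
  let bad : Finset (Fin n) → Finset (Finset (Finset (Fin n))) := fun X =>
    (crossing n k X Xᶜ).powerset.filter fun H => ¬ DeltaTypicalWrt n k δ H X Xᶜ
  have hsub : {H ∈ Bip n k | ¬ DeltaTypical n k δ H}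
      ⊆ ((Finset.univ.biUnion bad : Finset _) : Set (Finset (Finset (Fin n)))) := by
    rintro H ⟨⟨hH, -⟩, hnot⟩
    simp only [DeltaTypical, not_forall] at hnot
    obtain ⟨X, Y, hXY, hnot⟩ := hnot
    have hY : Y = Xᶜ := by
      rw [← (isCompl_iff.2 ⟨hXY.1, codisjoint_iff.2 hXY.2.1⟩).compl_eq]
    subst hY
    rw [Finset.mem_coe, Finset.mem_biUnion]
    exact ⟨X, Finset.mem_univ _, Finset.mem_filter.2
      ⟨Finset.mem_powerset.2 (subset_crossing hH hXY), hnot⟩⟩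
  have hcard : ({H ∈ Bip n k | ¬ DeltaTypical n k δ H}.ncard : ℝ)
      ≤ ∑ X : Finset (Fin n), (#(bad X) : ℝ) := by
    have h := Set.ncard_le_ncard hsub (Set.toFinite _)
    rw [Set.ncard_coe_finset] at h
    exact_mod_cast h.trans Finset.card_biUnion_le
  have hbad : ∀ X ∈ (Finset.univ : Finset (Finset (Fin n))), (#(bad X) : ℝ)
      ≤ 5 * 8 ^ n * (((Bip n k).ncard : ℝ) * (2 * Real.exp (-(2 * c * n ^ 2)))) := by
    intro X _
    have h := hpair n hn1 X Xᶜ disjoint_compl_right (Finset.union_compl X)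
    have he : δ ^ 2 * (κ * (n : ℝ) ^ 2) / 2 = 2 * c * n ^ 2 := by rw [hc]; ring
    rw [he] at h
    convert h
  have htotal := hcard.trans (Finset.sum_le_sum hbad)
  rw [Finset.sum_const, Finset.card_univ, Fintype.card_finset, Fintype.card_fin,
    nsmul_eq_mul] at htotal
  have he3 : (16 : ℝ) ≤ Real.exp 3 := by
    have h := Real.exp_one_gt_d9
    have h3 : Real.exp 3 = Real.exp 1 ^ 3 := by
      rw [← Real.exp_nat_mul]; norm_num
    rw [h3]
    calc (16 : ℝ) ≤ 2.7 ^ 3 := by norm_num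
      _ ≤ _ := by gcongr; linarith
  have hconst : (10 : ℝ) * 16 ^ n ≤ Real.exp (c * n ^ 2) := by
    calc (10 : ℝ) * 16 ^ n ≤ Real.exp 3 * Real.exp 3 ^ n := by gcongr; linarith
      _ = Real.exp (3 + n * 3) := by rw [← Real.exp_nat_mul, ← Real.exp_add]
      _ ≤ _ := by
        rw [Real.exp_le_exp]
        nlinarith
  have hpow : Real.exp (-(c * (n : ℝ) ^ 2)) ≤ (2 : ℝ) ^ (-(c * (n : ℝ) ^ 2)) := by
    rw [Real.rpow_def_of_pos (by norm_num), Real.exp_le_exp]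
    have h1 : 0 ≤ c * (n : ℝ) ^ 2 := by positivity
    nlinarith [Real.log_two_lt_d9]
  calc _ ≤ _ := htotal
    _ = ((Bip n k).ncard : ℝ) * ((10 * 16 ^ n) * Real.exp (-(2 * c * n ^ 2))) := by
      have h16 : (16 : ℝ) ^ n = 2 ^ n * 8 ^ n := by rw [← mul_pow]; norm_num
      rw [h16]
      push_cast
      ring
    _ ≤ ((Bip n k).ncard : ℝ) * (Real.exp (c * n ^ 2) * Real.exp (-(2 * c * n ^ 2))) := by
      gcongr
    _ = ((Bip n k).ncard : ℝ) * Real.exp (-(c * (n : ℝ) ^ 2)) := by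
      rw [← Real.exp_add]
      congr 2
      ring
    _ ≤ _ := by gcongr
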